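/- Let G′ be the graph obtained from G(L⁽²⁾,x,y,l,m) by replacing the copy Lₘ with a copy of L⁽³⁾ (with its distinguished vertices x = w₁, y = w₅ playing the roles of xₘ, yₘ). For all integers l ≥ 2 and m ≥ 1, the toughness of G′ equals (l + 3m + 1)/(2(m + 1)). -/

import Mathlib

open SimpleGraph

/-- Number of connected components of the subgraph induced on the complement of `S`. -/
noncomputable def numComponents {V : Type} (G : SimpleGraph V) (S : Set V) : ℕ :=
  Nat.card (G.induce Sᶜ).ConnectedComponent

/-- `G` is `t`-tough: `|S| ≥ t · ω(G \ S)` for every vertex subset `S`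
with `ω(G \ S) > 1`. -/
def IsTough {V : Type} (t : ℝ) (G : SimpleGraph V) : Prop :=
  ∀ S : Finset V, 1 < numComponents G ↑S →
    t * (numComponents G ↑S : ℝ) ≤ (S.card : ℝ)

/-- The toughness of `G` equals `t`: `t` is the greatest nonnegative real
for which `G` is `t`-tough. -/
def HasToughness {V : Type} (G : SimpleGraph V) (t : ℝ) : Prop :=
  IsGreatest {s : ℝ | 0 ≤ s ∧ IsTough s G} t

/-- A Hamiltonian cycle: a cycle whose support contains every vertex. -/
def IsHamCycle {V : Type} {G : SimpleGraph V} {v : V} (p : G.Walk v v) : Prop :=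
  p.IsCycle ∧ ∀ u, u ∈ p.support

/-- A graph is Hamiltonian if it contains a Hamiltonian cycle. -/
def IsHam {V : Type} (G : SimpleGraph V) : Prop :=
  ∃ (v : V) (p : G.Walk v v), IsHamCycle p

/-- `x` and `y` are connected by a Hamilton path of `G`: a path with endpoints
`x` and `y` containing every vertex of `G`. -/
def HamConnected {V : Type} (G : SimpleGraph V) (x y : V) : Prop :=
  ∃ p : G.Walk x y, p.IsPath ∧ ∀ v, v ∈ p.support

/-- `L⁽¹⁾`: the 8-cycle `w₁w₂…w₈w₁` (here `wᵢ = i - 1`) together with the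
edges `w₂w₄, w₄w₆, w₆w₈, w₂w₈`; `x = w₁ = 0`, `y = w₅ = 4`. -/
def L1 : SimpleGraph (Fin 8) := SimpleGraph.fromEdgeSet
  {s(0,1), s(1,2), s(2,3), s(3,4), s(4,5), s(5,6), s(6,7), s(7,0),
   s(1,3), s(3,5), s(5,7), s(1,7)}

/-- `L⁽²⁾`: obtained from `L⁽¹⁾` by deleting `w₁w₂, w₂w₈` and identifying `w₂`
with `w₈`.  Vertices `w₁, w, w₃, w₄, w₅, w₆, w₇` are `0, 1, 2, 3, 4, 5, 6`;
`x = w₁ = 0`, `y = w₅ = 4`. -/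
def L2 : SimpleGraph (Fin 7) := SimpleGraph.fromEdgeSet
  {s(0,1), s(1,2), s(2,3), s(3,4), s(4,5), s(5,6), s(6,1),
   s(1,3), s(3,5), s(5,1)}

/-- `L⁽³⁾`: obtained from `L⁽¹⁾` by adding a new vertex `w₉ = 8` and the edges
`w₄w₉, w₆w₉`; `x = w₁ = 0`, `y = w₅ = 4`. -/
def L3 : SimpleGraph (Fin 9) := SimpleGraph.fromEdgeSet
  {s(0,1), s(1,2), s(2,3), s(3,4), s(4,5), s(5,6), s(6,7), s(7,0),
   s(1,3), s(3,5), s(5,7), s(1,7), s(3,8), s(5,8)}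

/-- `L⁽⁴⁾`: the triangle `w₁w₂w₃w₁` together with pendant vertices `w₄, w₅`
and edges `w₁w₄, w₃w₅` (here `wᵢ = i - 1`); `x = w₄ = 3`, `y = w₅ = 4`. -/
def L4 : SimpleGraph (Fin 5) := SimpleGraph.fromEdgeSet
  {s(0,1), s(1,2), s(2,0), s(0,3), s(2,4)}

/-- A building block: a graph together with two distinguished vertices. -/
structure Block where
  V : Type
  G : SimpleGraph V
  x : V
  y : V

/-- The graph `G(L,x,y,l,m)` (allowing a different block for each of the `m`
copies): disjoint copies `L₁, …, Lₘ` of the blocks, all possible edges between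
pairs of vertices in `{x₁, …, xₘ, y₁, …, yₘ}`, joined with a complete graph
`T = Kₗ`. -/
def GGen {m : ℕ} (l : ℕ) (B : Fin m → Block) :
    SimpleGraph (Fin l ⊕ Σ i, (B i).V) :=
  SimpleGraph.fromRel fun a b =>
    (∃ t, a = Sum.inl t) ∨ (∃ t, b = Sum.inl t) ∨
    (∃ (i : Fin m) (u v : (B i).V),
      a = Sum.inr ⟨i, u⟩ ∧ b = Sum.inr ⟨i, v⟩ ∧ (B i).G.Adj u v) ∨
    (∃ p q : Σ i, (B i).V, a = Sum.inr p ∧ b = Sum.inr q ∧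
      (p.2 = (B p.1).x ∨ p.2 = (B p.1).y) ∧ (q.2 = (B q.1).x ∨ q.2 = (B q.1).y))

def blockL1 : Block := ⟨Fin 8, L1, 0, 4⟩
def blockL2 : Block := ⟨Fin 7, L2, 0, 4⟩
def blockL3 : Block := ⟨Fin 9, L3, 0, 4⟩
def blockL4 : Block := ⟨Fin 5, L4, 3, 4⟩

instance : DecidableRel L2.Adj := fun a b =>
  decidable_of_iff (s(a, b) ∈ [s(0,1), s(1,2), s(2,3), s(3,4), s(4,5), s(5,6), s(6,1),
   s(1,3), s(3,5), s(5,1)] ∧ a ≠ b) (by simp [L2])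

instance : DecidableRel L3.Adj := fun a b =>
  decidable_of_iff (s(a, b) ∈ [s(0,1), s(1,2), s(2,3), s(3,4), s(4,5), s(5,6), s(6,7), s(7,0),
   s(1,3), s(3,5), s(5,7), s(1,7), s(3,8), s(5,8)] ∧ a ≠ b) (by simp [L3])

/-- Every vertex outside `S` is joined, by a walk avoiding `S`, to a vertex of `A`. -/
def SimpleGraph.ReachesAvoiding {V : Type} (G : SimpleGraph V) (S A : Set V) : Prop :=
  ∀ v ∉ S, ∃ r ∈ A, Relation.ReflTransGen (fun a b => G.Adj a b ∧ b ∉ S) v r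

/-- If, outside `S`, every vertex not in `A` has a neighbour of smaller rank, then descending
along the rank leads into `A`. -/
theorem SimpleGraph.ReachesAvoiding.of_rank {V : Type} {G : SimpleGraph V} {S A : Set V}
    (ρ : V → ℕ) (h : ∀ v ∉ S, v ∈ A ∨ ∃ u ∉ S, G.Adj v u ∧ ρ u < ρ v) :
    G.ReachesAvoiding S A := by
  intro v
  induction hn : ρ v using Nat.strong_induction_on generalizing v with
  | _ n ih =>
    intro hv
    rcases h v hv with hA | ⟨u, hu, huv, hlt⟩
    · exact ⟨v, hA, .refl⟩
    · obtain ⟨r, hr, hur⟩ := ih _ (hn ▸ hlt) u rfl hu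
      exact ⟨r, hr, .head ⟨huv, hu⟩ hur⟩

/-- Deleting a set `S` from the block leaves at most `2 + e` components, and at most
`(2 |S| + e) / 3` components, that avoid both distinguished vertices. -/
def Block.ComponentBound (B : Block) (e : ℕ) : Prop :=
  ∀ S : Finset B.V, ∃ R : Finset B.V, B.G.ReachesAvoiding S ({B.x, B.y} ∪ R) ∧
    R.card ≤ 2 + e ∧ 3 * R.card ≤ 2 * S.card + e

/-- Deleting some set of `3 + e` vertices from the block isolates `2 + e` of the vertices that
are not distinguished, and leaves `x` in place. -/
def Block.HasIsolatingCut (B : Block) (e : ℕ) : Prop :=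
  ∃ S W : Finset B.V, S.card = 3 + e ∧ W.card = 2 + e ∧ Disjoint S W ∧
    B.x ∉ S ∧ B.x ∉ W ∧ B.y ∉ W ∧ ∀ w ∈ W, ∀ v, B.G.Adj w v → v ∈ S

/-- The vertices outside `S`, other than `x` and `y`, without a neighbour of smaller rank
outside `S`. -/
def SimpleGraph.localMinima {n : ℕ} (G : SimpleGraph (Fin n)) [DecidableRel G.Adj] (x y : Fin n)
    (ρ : Fin n → ℕ) (S : Finset (Fin n)) : Finset (Fin n) :=
  {v | v ∉ S ∧ v ≠ x ∧ v ≠ y ∧ ¬ ∃ u, u ∉ S ∧ G.Adj v u ∧ ρ u < ρ v}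

theorem Block.ComponentBound.of_localMinima {n : ℕ} {G : SimpleGraph (Fin n)}
    [DecidableRel G.Adj] {x y : Fin n} {e : ℕ}
    (h : ∀ S : Finset (Fin n), ∃ ρ : Fin n → ℕ, (G.localMinima x y ρ S).card ≤ 2 + e ∧
      3 * (G.localMinima x y ρ S).card ≤ 2 * S.card + e) :
    Block.ComponentBound ⟨Fin n, G, x, y⟩ e := by
  intro (S : Finset (Fin n))
  obtain ⟨ρ, h1, h2⟩ := h S
  refine ⟨G.localMinima x y ρ S, .of_rank ρ fun (v : Fin n) (hv : v ∉ (S : Set (Fin n))) => ?_,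
    h1, h2⟩
  change v ∈ ({x, y} ∪ (G.localMinima x y ρ S : Set (Fin n)) : Set (Fin n)) ∨
    ∃ u ∉ (S : Set (Fin n)), G.Adj v u ∧ ρ u < ρ v
  simp only [SimpleGraph.localMinima, Set.mem_union, Set.mem_insert_iff, Set.mem_singleton_iff,
    Finset.mem_coe, Finset.mem_filter_univ] at hv ⊢
  tauto

theorem componentBound_blockL2 : blockL2.ComponentBound 0 := by
  refine .of_localMinima fun S => ?_
  have h : ∀ S, ∃ ρ ∈ [![0, 1, 4, 3, 2, 5, 6], ![0, 3, 4, 2, 1, 5, 6]],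
      (L2.localMinima 0 4 ρ S).card ≤ 2 + 0 ∧
        3 * (L2.localMinima 0 4 ρ S).card ≤ 2 * S.card + 0 := by
    decide +kernel
  exact (h S).imp fun _ => And.right

theorem componentBound_blockL3 : blockL3.ComponentBound 1 := by
  refine .of_localMinima fun S => ⟨![0, 3, 8, 2, 1, 5, 7, 4, 6], ?_⟩
  revert S
  decide +kernel

theorem hasIsolatingCut_blockL2 : blockL2.HasIsolatingCut 0 := by
  refine ⟨({1, 3, 5} : Finset (Fin 7)), ({2, 6} : Finset (Fin 7)), rfl, rfl, ?_⟩
  change Disjoint ({1, 3, 5} : Finset (Fin 7)) {2, 6} ∧ (0 : Fin 7) ∉ ({1, 3, 5} : Finset (Fin 7)) ∧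
    (0 : Fin 7) ∉ ({2, 6} : Finset (Fin 7)) ∧ (4 : Fin 7) ∉ ({2, 6} : Finset (Fin 7)) ∧
    ∀ w ∈ ({2, 6} : Finset (Fin 7)), ∀ v, L2.Adj w v → v ∈ ({1, 3, 5} : Finset (Fin 7))
  decide +kernel

theorem hasIsolatingCut_blockL3 : blockL3.HasIsolatingCut 1 := by
  refine ⟨({1, 3, 5, 7} : Finset (Fin 9)), ({2, 6, 8} : Finset (Fin 9)), rfl, rfl, ?_⟩
  change Disjoint ({1, 3, 5, 7} : Finset (Fin 9)) {2, 6, 8} ∧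
    (0 : Fin 9) ∉ ({1, 3, 5, 7} : Finset (Fin 9)) ∧
    (0 : Fin 9) ∉ ({2, 6, 8} : Finset (Fin 9)) ∧ (4 : Fin 9) ∉ ({2, 6, 8} : Finset (Fin 9)) ∧
    ∀ w ∈ ({2, 6, 8} : Finset (Fin 9)), ∀ v, L3.Adj w v → v ∈ ({1, 3, 5, 7} : Finset (Fin 9))
  decide +kernel

theorem SimpleGraph.induce_reachable_of_adj {V : Type} {G : SimpleGraph V} {s : Set V} {a b : V}
    (ha : a ∈ s) (hb : b ∈ s) (h : G.Adj a b) : (G.induce s).Reachable ⟨a, ha⟩ ⟨b, hb⟩ :=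
  SimpleGraph.Adj.reachable h

section GGen

variable {m l : ℕ} {B : Fin m → Block}

theorem GGen_adj_inl {t : Fin l} {b : Fin l ⊕ Σ i, (B i).V} (h : Sum.inl t ≠ b) :
    (GGen l B).Adj (Sum.inl t) b := by
  simp [GGen, h]

theorem GGen_adj_of_block {i : Fin m} {u v : (B i).V} (h : (B i).G.Adj u v) :
    (GGen l B).Adj (Sum.inr ⟨i, u⟩) (Sum.inr ⟨i, v⟩) := by
  refine ⟨by simpa using h.ne, .inl (.inr (.inr (.inl ⟨i, u, v, rfl, rfl, h⟩)))⟩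

theorem GGen_adj_core {i j : Fin m} {u : (B i).V} {v : (B j).V}
    (hu : u = (B i).x ∨ u = (B i).y) (hv : v = (B j).x ∨ v = (B j).y)
    (h : (Sum.inr ⟨i, u⟩ : Fin l ⊕ Σ i, (B i).V) ≠ Sum.inr ⟨j, v⟩) :
    (GGen l B).Adj (Sum.inr ⟨i, u⟩) (Sum.inr ⟨j, v⟩) :=
  ⟨h, .inl (.inr (.inr (.inr ⟨_, _, rfl, rfl, hu, hv⟩)))⟩

/-- A vertex of a block that is not distinguished has only block neighbours and `T`. -/
theorem GGen_adj_inner {i : Fin m} {w : (B i).V} (hx : w ≠ (B i).x) (hy : w ≠ (B i).y)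
    {b : Fin l ⊕ Σ i, (B i).V} (h : (GGen l B).Adj (Sum.inr ⟨i, w⟩) b) :
    (∃ t, b = Sum.inl t) ∨ ∃ v, b = Sum.inr ⟨i, v⟩ ∧ (B i).G.Adj w v := by
  obtain ⟨-, h | h⟩ := h
  · rcases h with ⟨t, ht⟩ | ht | ⟨j, u, v, h1, rfl, h3⟩ | ⟨p, q, h1, -, h3, -⟩
    · simp at ht
    · exact .inl ht
    · obtain ⟨rfl, h1⟩ := Sigma.mk.inj (Sum.inr_injective h1)
      obtain rfl := eq_of_heq h1
      exact .inr ⟨v, rfl, h3⟩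
    · obtain rfl := Sum.inr_injective h1
      exact absurd h3 (by simp [hx, hy])
  · rcases h with ht | ⟨t, ht⟩ | ⟨j, u, v, rfl, h1, h3⟩ | ⟨p, q, -, h1, -, h3⟩
    · exact .inl ht
    · simp at ht
    · obtain ⟨rfl, h1⟩ := Sigma.mk.inj (Sum.inr_injective h1)
      obtain rfl := eq_of_heq h1
      exact .inr ⟨u, rfl, h3.symm⟩
    · obtain rfl := Sum.inr_injective h1
      exact absurd h3 (by simp [hx, hy])

theorem numComponents_GGen_le_one {S : Set (Fin l ⊕ Σ i, (B i).V)} {t : Fin l}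
    (ht : Sum.inl t ∉ S) : numComponents (GGen l B) S ≤ 1 := by
  have key (c : ((GGen l B).induce Sᶜ).ConnectedComponent) :
      c = SimpleGraph.connectedComponentMk _ ⟨Sum.inl t, ht⟩ := by
    induction c using SimpleGraph.ConnectedComponent.ind with | _ v
    obtain ⟨v, hv⟩ := v
    by_cases h : Sum.inl t = v
    · subst h; rfl
    · exact SimpleGraph.ConnectedComponent.sound
        (SimpleGraph.induce_reachable_of_adj ht hv (GGen_adj_inl h)).symm
  have : Subsingleton ((GGen l B).induce Sᶜ).ConnectedComponent :=
    ⟨fun a b => (key a).trans (key b).symm⟩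
  exact Finite.card_le_one_iff_subsingleton.2 this

/-- Vertices of a block joined inside the block by a walk avoiding `S` lie in one component. -/
theorem GGen_reachable_of_block {S : Set (Fin l ⊕ Σ i, (B i).V)} {i : Fin m}
    {S' : Set (B i).V} (hS : ∀ v, v ∈ S' ↔ Sum.inr ⟨i, v⟩ ∈ S) {u v : (B i).V}
    (hu : Sum.inr ⟨i, u⟩ ∈ Sᶜ)
    (h : Relation.ReflTransGen (fun a b => (B i).G.Adj a b ∧ b ∉ S') u v) :
    ∃ hv : Sum.inr ⟨i, v⟩ ∈ Sᶜ,
      ((GGen l B).induce Sᶜ).Reachable ⟨Sum.inr ⟨i, u⟩, hu⟩ ⟨Sum.inr ⟨i, v⟩, hv⟩ := by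
  induction h with
  | refl => exact ⟨hu, .rfl⟩
  | tail _ h ih =>
    obtain ⟨hb, ih⟩ := ih
    refine ⟨(hS _).not.1 h.2, ih.trans ?_⟩
    exact SimpleGraph.induce_reachable_of_adj _ _ (GGen_adj_of_block h.1)

theorem numComponents_GGen_le {S : Set (Fin l ⊕ Σ i, (B i).V)} (hT : ∀ t, Sum.inl t ∈ S)
    (S' : ∀ i, Set (B i).V) (hS : ∀ i v, v ∈ S' i ↔ Sum.inr ⟨i, v⟩ ∈ S)
    (R : ∀ i, Finset (B i).V)
    (hR : ∀ i, (B i).G.ReachesAvoiding (S' i) ({(B i).x, (B i).y} ∪ R i)) :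
    numComponents (GGen l B) S ≤ 1 + ∑ i, (R i).card := by
  classical
  let P (c : ((GGen l B).induce Sᶜ).ConnectedComponent) : Option (Σ i, R i) → Prop
    | none => ∃ (i : Fin m) (v : (B i).V) (hv : Sum.inr ⟨i, v⟩ ∉ S),
        (v = (B i).x ∨ v = (B i).y) ∧ c = SimpleGraph.connectedComponentMk _ ⟨_, hv⟩
    | some p => ∃ hv : Sum.inr ⟨p.1, p.2⟩ ∉ S, c = SimpleGraph.connectedComponentMk _ ⟨_, hv⟩
  have hP (c) : ∃ o, P c o := by
    induction c using SimpleGraph.ConnectedComponent.ind with | _ v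
    obtain ⟨t | ⟨i, v⟩, hv⟩ := v
    · exact absurd (hT t) hv
    obtain ⟨r, hr, hvr⟩ := hR i v ((hS i v).not.2 hv)
    obtain ⟨hrS, hreach⟩ := GGen_reachable_of_block (hS i) hv hvr
    rcases hr with hr | hr
    · exact ⟨none, i, r, hrS, hr, SimpleGraph.ConnectedComponent.sound hreach⟩
    · exact ⟨some ⟨i, r, hr⟩, hrS, SimpleGraph.ConnectedComponent.sound hreach⟩
  choose f hf using hP
  have hinj : Function.Injective f := by
    intro c d hcd
    have hc := hf c
    have hd := hf d
    rw [← hcd] at hd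
    generalize f c = o at hc hd
    rcases o with _ | p
    · obtain ⟨i, u, hu, hu', rfl⟩ := hc
      obtain ⟨j, v, hv, hv', rfl⟩ := hd
      by_cases h : (Sum.inr ⟨i, u⟩ : Fin l ⊕ Σ i, (B i).V) = Sum.inr ⟨j, v⟩
      · congr
      · exact SimpleGraph.ConnectedComponent.sound
          (SimpleGraph.induce_reachable_of_adj hu hv (GGen_adj_core hu' hv' h))
    · obtain ⟨_, rfl⟩ := hc
      obtain ⟨_, rfl⟩ := hd
      rfl
  refine (Nat.card_le_card_of_injective f hinj).trans ?_
  simp [add_comm]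

/-- Isolated vertices of `G \ S` together with one further vertex give distinct components. -/
theorem card_add_one_le_numComponents {V : Type} [Finite V] {G : SimpleGraph V} {S : Set V}
    {W : Finset V} (hW : ∀ w ∈ W, w ∉ S ∧ ∀ v, G.Adj w v → v ∈ S) {u : V} (hu : u ∉ S)
    (huW : u ∉ W) : W.card + 1 ≤ numComponents G S := by
  classical
  have hsep {a b : (Sᶜ : Set V)} (ha : (a : V) ∈ W) (h : (G.induce Sᶜ).Reachable a b) : a = b := by
    obtain ⟨p⟩ := h
    cases p with
    | nil => rfl
    | @cons _ c _ h _ => exact absurd ((hW a ha).2 c h) c.2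
  let g : {w // w ∈ insert u W} → (G.induce Sᶜ).ConnectedComponent := fun w =>
    (G.induce Sᶜ).connectedComponentMk ⟨w.1, by
      rcases Finset.mem_insert.1 w.2 with h | h
      · rwa [h]
      · exact (hW _ h).1⟩
  have hg : Function.Injective g := by
    intro a b hab
    have hr := SimpleGraph.ConnectedComponent.exact hab
    by_cases ha : a.1 ∈ W
    · exact Subtype.ext (congrArg (fun z => z.1) (hsep (by exact ha) hr))
    by_cases hb : b.1 ∈ W
    · exact Subtype.ext (congrArg (fun z => z.1) (hsep (by exact hb) hr.symm)).symm
    have ha' := (Finset.mem_insert.1 a.2).resolve_right ha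
    have hb' := (Finset.mem_insert.1 b.2).resolve_right hb
    exact Subtype.ext (ha'.trans hb'.symm)
  have := Nat.card_le_card_of_injective g hg
  rwa [Nat.card_eq_fintype_card, Fintype.card_coe, Finset.card_insert_of_notMem huW] at this

/-- If the `i`-th block satisfies the `ComponentBound` and has an isolating cut for `e i`, and
`∑ i, e i = 1`, then the toughness of `G(B, l)` is `(l + 3m + 1) / (2 (m + 1))`. -/
theorem hasToughness_GGen [∀ i, Finite (B i).V] (hl : 2 ≤ l) (hm : 0 < m) (e : Fin m → ℕ)
    (he : ∑ i, e i = 1) (hB : ∀ i, (B i).ComponentBound (e i))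
    (hC : ∀ i, (B i).HasIsolatingCut (e i)) :
    HasToughness (GGen l B) (((l : ℝ) + 3 * m + 1) / (2 * (m + 1))) := by
  classical
  refine ⟨⟨by positivity, fun S hS => ?_⟩, fun s hs => ?_⟩
  · have hT : ∀ t, Sum.inl t ∈ S := by
      intro t
      by_contra ht
      exact absurd (numComponents_GGen_le_one (B := B) (S := ↑S) (t := t) (by simpa using ht))
        (by omega)
    let S' (i : Fin m) : Finset (B i).V :=
      S.toRight.preimage (fun v => ⟨i, v⟩) fun _ _ _ _ h => by simpa using h
    have hS' (i) (v) : v ∈ S' i ↔ Sum.inr ⟨i, v⟩ ∈ S :=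
      Finset.mem_preimage.trans Finset.mem_toRight
    choose R hR hR1 hR2 using fun i => hB i (S' i)
    have hN := numComponents_GGen_le (S := (S : Set (Fin l ⊕ Σ i, (B i).V)))
      (by simpa using hT) (fun i => S' i) (by simpa using hS') R hR
    have hcard : S.card = l + ∑ i, (S' i).card := by
      have h1 : S.toLeft = Finset.univ := by ext; simpa using hT _
      have h2 : S.toRight = Finset.univ.sigma S' := by ext ⟨i, v⟩; simp [hS']
      rw [← Finset.card_toLeft_add_card_toRight, h1, h2, Finset.card_sigma]
      simp
    have h1 : ∑ i, (R i).card ≤ 2 * m + 1 := by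
      refine (Finset.sum_le_sum fun i _ => hR1 i).trans ?_
      simp [Finset.sum_add_distrib, he, mul_comm]
    have h2 : 3 * ∑ i, (R i).card ≤ 2 * ∑ i, (S' i).card + 1 := by
      rw [Finset.mul_sum, Finset.mul_sum, ← he, ← Finset.sum_add_distrib]
      exact Finset.sum_le_sum fun i _ => hR2 i
    generalize numComponents (GGen l B) ↑S = N at *
    generalize ∑ i, (R i).card = r at *
    generalize ∑ i, (S' i).card = σ at *
    have hN' : N ≤ 2 * m + 2 := by omega
    have hσ : 3 * N ≤ 2 * σ + 4 := by omega
    have hl' : (2 : ℝ) ≤ l := by exact_mod_cast hl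
    have hN'' : (N : ℝ) ≤ 2 * m + 2 := by exact_mod_cast hN'
    have hσ' : 3 * (N : ℝ) ≤ 2 * σ + 4 := by exact_mod_cast hσ
    rw [hcard, div_mul_eq_mul_div, div_le_iff₀ (by positivity)]
    push_cast
    nlinarith [mul_nonneg (sub_nonneg.2 hl') (sub_nonneg.2 hN''),
      mul_nonneg (sub_nonneg.2 hσ') (by positivity : (0 : ℝ) ≤ m + 1)]
  · choose C W hC1 hW1 hCW hxC hxW hyW hW using hC
    let S : Finset (Fin l ⊕ Σ i, (B i).V) := Finset.univ.disjSum (Finset.univ.sigma C)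
    let W' : Finset (Fin l ⊕ Σ i, (B i).V) :=
      (∅ : Finset (Fin l)).disjSum (Finset.univ.sigma W)
    have hcard : S.card = l + 3 * m + 1 := by
      simp [S, hC1, Finset.sum_add_distrib, he]
      ring
    have hcardW : W'.card = 2 * m + 1 := by
      simp [W', hW1, Finset.sum_add_distrib, he]
      ring
    have hN : 2 * m + 2 ≤ numComponents (GGen l B) S := by
      have := card_add_one_le_numComponents (G := GGen l B) (S := S) (W := W')
        (u := Sum.inr ⟨⟨0, hm⟩, (B ⟨0, hm⟩).x⟩) ?_ (by simp [S, hxC]) (by simp [W', hxW])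
      · omega
      · rintro (t | ⟨i, w⟩) hw
        · simp [W'] at hw
        have hw : w ∈ W i := by simpa [W'] using hw
        refine ⟨by simpa [S] using Finset.disjoint_right.1 (hCW i) hw, fun v hv => ?_⟩
        rcases GGen_adj_inner (fun h => hxW i (h ▸ hw)) (fun h => hyW i (h ▸ hw)) hv with
          ⟨t, rfl⟩ | ⟨v, rfl, hwv⟩
        · simp [S]
        · simpa [S] using hW i w hw v hwv
    have h := hs.2 S (by omega)
    rw [hcard] at h
    rw [le_div_iff₀ (by positivity)]
    have hN' : (2 * m + 2 : ℝ) ≤ numComponents (GGen l B) S := by exact_mod_cast hN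
    push_cast at h
    nlinarith [mul_le_mul_of_nonneg_left hN' hs.1]

end GGen

/-- Claim 4: for `l ≥ 2` and `m ≥ 1`, the graph `G′` obtained from
`G(L⁽²⁾,x,y,l,m)` by replacing the copy `Lₘ` with a copy of `L⁽³⁾` has
toughness `(l + 3m + 1)/(2(m + 1))`. -/
theorem toughness_GGen_L2_L3 (l m : ℕ) (hl : 2 ≤ l) (hm : 1 ≤ m) :
    HasToughness
      (GGen l (fun i : Fin m => if (i : ℕ) = m - 1 then blockL3 else blockL2))
      (((l : ℝ) + 3 * m + 1) / (2 * (m + 1))) := by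
  have : ∀ i : Fin m,
      Finite (if (i : ℕ) = m - 1 then blockL3 else blockL2).V := by
    intro i
    split_ifs
    · exact inferInstanceAs (Finite (Fin 9))
    · exact inferInstanceAs (Finite (Fin 7))
  refine hasToughness_GGen hl hm (fun i => if (i : ℕ) = m - 1 then 1 else 0) ?_ ?_ ?_
  · have (i : Fin m) : (i : ℕ) = m - 1 ↔ i = ⟨m - 1, by omega⟩ := by
      rw [Fin.ext_iff]
    simp [this]
  · intro i
    split_ifs
    exacts [componentBound_blockL3, componentBound_blockL2]
  · intro i
    split_ifs
    exacts [hasIsolatingCut_blockL3, hasIsolatingCut_blockL2]
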